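/- Under the stated hypotheses, the function G(p) := p·v(p)/((1−p)·φ(√(2r)·v(p))) is strictly decreasing on (0,b). -/

import Mathlib

/-- The standard normal density `φ(z) = exp(-z²/2)/√(2π)`. -/
noncomputable def npdf (z : ℝ) : ℝ := (Real.sqrt (2 * Real.pi))⁻¹ * Real.exp (-z ^ 2 / 2)

/-- The standard normal distribution function `Φ(y) = ∫_{-∞}^y φ(z) dz`. -/
noncomputable def ncdf (y : ℝ) : ℝ := ∫ z in Set.Iic y, npdf z

/-- The standard normal tail function `Ψ(y) = 1 - Φ(y)`. -/
noncomputable def ntail (y : ℝ) : ℝ := 1 - ncdf y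

/-- The function `F(y) = φ(y) - y·Ψ(y)`. -/
noncomputable def Fstat (y : ℝ) : ℝ := npdf y - y * ntail y

open MeasureTheory Set in
lemma npdf_eq_aux : npdf = ProbabilityTheory.gaussianPDFReal 0 1 := by
  funext z
  simp [npdf, ProbabilityTheory.gaussianPDFReal]

open MeasureTheory Set in
lemma npdf_int_aux : Integrable npdf := by
  rw [npdf_eq_aux]; exact ProbabilityTheory.integrable_gaussianPDFReal 0 1

lemma npdf_pos_aux (z : ℝ) : 0 < npdf z := by
  unfold npdf; positivity

open MeasureTheory Set in
lemma ntail_eq_aux (y : ℝ) : ntail y = ∫ z in Ioi y, npdf z := by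
  have h1 : ∫ z, npdf z = 1 := by
    rw [npdf_eq_aux]; exact ProbabilityTheory.integral_gaussianPDFReal_eq_one 0 one_ne_zero
  have h2 := integral_add_compl (measurableSet_Iic (a := y)) npdf_int_aux
  rw [compl_Iic, h1] at h2
  unfold ntail ncdf
  linarith

open MeasureTheory Set in
lemma ntail_anti_aux {x y : ℝ} (h : x ≤ y) : ntail y ≤ ntail x := by
  rw [ntail_eq_aux, ntail_eq_aux]
  exact setIntegral_mono_set npdf_int_aux.integrableOn
    (Filter.Eventually.of_forall fun z => (npdf_pos_aux z).le)
    (Ioi_subset_Ioi h).eventuallyLE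

open MeasureTheory Set in
lemma mills_aux {y : ℝ} (hy : 0 < y) :
    y * ntail y / npdf y = ∫ u in Ioi (0:ℝ), Real.exp (-u - u ^ 2 / (2 * y ^ 2)) := by
  have h1 : ∫ x in Ioi (0:ℝ), npdf (x + y) = ntail y := by
    have := (measurePreserving_add_right volume y).setIntegral_preimage_emb
      (measurableEmbedding_addRight y) npdf (Ioi y)
    rw [ntail_eq_aux, ← this]
    simp
  have h2 := integral_comp_mul_left_Ioi
    (fun u : ℝ => Real.exp (-u - u ^ 2 / (2 * y ^ 2))) 0 hy
  have h3 : ∀ x : ℝ, npdf (x + y)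
      = npdf y * Real.exp (-(y * x) - (y * x) ^ 2 / (2 * y ^ 2)) := by
    intro x
    unfold npdf
    rw [mul_assoc, ← Real.exp_add]
    congr 2
    field_simp
    ring
  simp_rw [h3] at h1
  rw [integral_const_mul, h2, mul_zero, smul_eq_mul] at h1
  have := (npdf_pos_aux y).ne'
  rw [← h1]
  field_simp

open MeasureTheory Set in
lemma mills_int_aux (y : ℝ) :
    IntegrableOn (fun u : ℝ => Real.exp (-u - u ^ 2 / (2 * y ^ 2))) (Ioi 0) := by
  refine Integrable.mono' (integrableOn_exp_neg_Ioi 0) ?_ ?_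
  · exact (by fun_prop : Continuous fun u : ℝ => Real.exp (-u - u ^ 2 / (2 * y ^ 2))).aestronglyMeasurable
  · refine Filter.Eventually.of_forall fun u => ?_
    rw [Real.norm_of_nonneg (Real.exp_pos _).le, Real.exp_le_exp]
    have : 0 ≤ u ^ 2 / (2 * y ^ 2) := by positivity
    linarith

open MeasureTheory Set in
lemma mills_strict_aux {x y : ℝ} (hx : 0 < x) (hxy : x < y) :
    x * ntail x / npdf x < y * ntail y / npdf y := by
  have hy := hx.trans hxy
  rw [mills_aux hx, mills_aux hy, ← sub_pos, ← integral_sub (mills_int_aux y) (mills_int_aux x)]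
  have key : ∀ u ∈ Ioi (0:ℝ), 0 < Real.exp (-u - u ^ 2 / (2 * y ^ 2))
      - Real.exp (-u - u ^ 2 / (2 * x ^ 2)) := by
    intro u hu
    have hu : 0 < u := hu
    rw [sub_pos, Real.exp_lt_exp]
    have : u ^ 2 / (2 * y ^ 2) < u ^ 2 / (2 * x ^ 2) := by gcongr
    linarith
  rw [setIntegral_pos_iff_support_of_nonneg_ae]
  · refine lt_of_lt_of_le ?_ (measure_mono (s := Ioi (0:ℝ)) fun u hu => ⟨(key u hu).ne', hu⟩)
    simp
  · exact (ae_restrict_iff' measurableSet_Ioi).2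
      (Filter.Eventually.of_forall fun u hu => (key u hu).le)
  · exact (mills_int_aux y).sub (mills_int_aux x)

/-- with Ψ(√(2r)·v(p)) = c·p/(1−p) on (0,b), the function
G(p) = p·v(p)/((1−p)·φ(√(2r)·v(p))) is strictly decreasing on (0,b). -/
theorem G_strictAnti (r b c : ℝ) (v : ℝ → ℝ) (hr : 0 < r)
    (hb : b ∈ Set.Ioo (0:ℝ) 1) (hc : 0 < c)
    (hcb : ∀ p ∈ Set.Ioo (0:ℝ) b, c * p / (1 - p) < 1/2)
    (hv : ∀ p ∈ Set.Ioo (0:ℝ) b, 0 < v p ∧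
      ntail (Real.sqrt (2*r) * v p) = c * p / (1 - p)) :
    StrictAntiOn (fun p => p * v p / ((1 - p) * npdf (Real.sqrt (2*r) * v p)))
      (Set.Ioo (0:ℝ) b) := by
  have hs : 0 < Real.sqrt (2 * r) := Real.sqrt_pos.2 (by linarith)
  intro p hp q hq hpq
  obtain ⟨hvp, hp2⟩ := hv p hp
  obtain ⟨hvq, hq2⟩ := hv q hq
  have hp1 : 0 < 1 - p := by linarith [hp.2, hb.2]
  have hq1 : 0 < 1 - q := by linarith [hq.2, hb.2]
  have hlt : ntail (Real.sqrt (2 * r) * v p) < ntail (Real.sqrt (2 * r) * v q) := by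
    rw [hp2, hq2, div_lt_div_iff₀ hp1 hq1]
    nlinarith
  have hyy : Real.sqrt (2 * r) * v q < Real.sqrt (2 * r) * v p := by
    by_contra h
    exact absurd (ntail_anti_aux (not_lt.1 h)) (not_le.2 hlt)
  have hm := mills_strict_aux (mul_pos hs hvq) hyy
  have e : ∀ t, 0 < 1 - t → ntail (Real.sqrt (2 * r) * v t) = c * t / (1 - t) →
      t * v t / ((1 - t) * npdf (Real.sqrt (2 * r) * v t))
      = (c * Real.sqrt (2 * r))⁻¹ * (Real.sqrt (2 * r) * v t * ntail (Real.sqrt (2 * r) * v t)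
        / npdf (Real.sqrt (2 * r) * v t)) := by
    intro t ht h
    have := (npdf_pos_aux (Real.sqrt (2 * r) * v t)).ne'
    rw [h]
    generalize npdf (Real.sqrt (2 * r) * v t) = N at *
    field_simp
  show q * v q / _ < p * v p / _
  rw [e p hp1 hp2, e q hq1 hq2]
  exact mul_lt_mul_of_pos_left hm (by positivity)
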